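/- For every integer k ≥ 1 there is an integer ℓ (namely ℓ = 2k + 2) such that for all sufficiently large n there exists a k-outerplanar plane graph G with n vertices in which every bounded face has length at most ℓ and the em-width of G satisfies emw(G) ≥ (ℓ/2 − 1)(2k − 1). -/

import Mathlib

open Set Bornology

/-- A plane embedding of a simple graph: each vertex is mapped to a point of the
plane, each edge to an injective arc joining its endpoints; arcs avoid vertices
other than their endpoints and distinct arcs meet only at common endpoints. -/
structure PlaneEmbedding {V : Type} (G : SimpleGraph V) where
  pos : V → ℝ × ℝ
  pos_inj : Function.Injective pos
  arc : G.edgeSet → Set (ℝ × ℝ)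
  arc_path : ∀ e : G.edgeSet, ∃ u v : V, (e : Sym2 V) = s(u, v) ∧
    ∃ γ : Path (pos u) (pos v), Function.Injective ⇑γ ∧ Set.range ⇑γ = arc e
  arc_avoid : ∀ (e : G.edgeSet) (w : V), pos w ∈ arc e → w ∈ (e : Sym2 V)
  arc_inter : ∀ e f : G.edgeSet, e ≠ f → ∀ x ∈ arc e ∩ arc f,
    ∃ w : V, w ∈ (e : Sym2 V) ∧ w ∈ (f : Sym2 V) ∧ x = pos w

namespace PlaneEmbedding

variable {V : Type} {G : SimpleGraph V}

/-- The image (drawing) of the plane graph in the plane. -/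
def image (P : PlaneEmbedding G) : Set (ℝ × ℝ) :=
  Set.range P.pos ∪ ⋃ e : G.edgeSet, P.arc e

/-- A face: a connected component of the complement of the image. -/
def IsFace (P : PlaneEmbedding G) (f : Set (ℝ × ℝ)) : Prop :=
  ∃ x, x ∉ P.image ∧ f = connectedComponentIn (P.image)ᶜ x

def IsBoundedFace (P : PlaneEmbedding G) (f : Set (ℝ × ℝ)) : Prop :=
  P.IsFace f ∧ IsBounded f

def IsOuterFace (P : PlaneEmbedding G) (f : Set (ℝ × ℝ)) : Prop :=
  P.IsFace f ∧ ¬ IsBounded f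

/-- The vertices on the boundary of a face `f`. -/
def boundaryVerts (P : PlaneEmbedding G) (f : Set (ℝ × ℝ)) : Set V :=
  {v | P.pos v ∈ closure f}

/-- The weak dual: vertices are the bounded faces, two distinct faces being
adjacent when some edge lies on the boundary of both. -/
def weakDual (P : PlaneEmbedding G) :
    SimpleGraph {f : Set (ℝ × ℝ) // P.IsBoundedFace f} :=
  SimpleGraph.fromRel fun f g =>
    ∃ e : G.edgeSet, P.arc e ⊆ closure f.1 ∧ P.arc e ⊆ closure g.1

/-- `u⁺`: the bounded faces having `u` on their boundary. -/
def uPlus (P : PlaneEmbedding G) (u : V) :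
    Set {f : Set (ℝ × ℝ) // P.IsBoundedFace f} :=
  {f | u ∈ P.boundaryVerts f.1}

/-- The drawing of the subgraph induced by a set `S` of vertices. -/
def subImage (P : PlaneEmbedding G) (S : Set V) : Set (ℝ × ℝ) :=
  P.pos '' S ∪ ⋃ e ∈ {e : G.edgeSet | ∀ w, w ∈ (e : Sym2 V) → w ∈ S}, P.arc e

/-- The vertices of `S` lying on the boundary of the unbounded face of the
drawing of the subgraph induced by `S`. -/
def outerVerts (P : PlaneEmbedding G) (S : Set V) : Set V :=
  {v | v ∈ S ∧ ∃ x, x ∉ P.subImage S ∧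
    ¬ IsBounded (connectedComponentIn (P.subImage S)ᶜ x) ∧
    P.pos v ∈ closure (connectedComponentIn (P.subImage S)ᶜ x)}

/-- Remove the outer layer of vertices. -/
def peel (P : PlaneEmbedding G) (S : Set V) : Set V := S \ P.outerVerts S

/-- The embedding is (at most) `k`-outerplanar: `k` rounds of removing the
vertices on the outer boundary remove every vertex. -/
def OuterplanarAtMost (P : PlaneEmbedding G) (k : ℕ) : Prop :=
  (P.peel)^[k] Set.univ = ∅

/-- The drawing of the subgraph of all edges incident to vertices of `R`. -/
def familyImage (P : PlaneEmbedding G) (R : Set V) : Set (ℝ × ℝ) :=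
  ⋃ e ∈ {e : G.edgeSet | ∃ v ∈ R, v ∈ (e : Sym2 V)}, P.arc e

/-- `R` is nicely embedded: no bounded face of the subgraph of edges incident
to `R` strictly encloses a vertex of `G`. -/
def NicelyEmbedded (P : PlaneEmbedding G) (R : Set V) : Prop :=
  ∀ x, x ∉ P.familyImage R →
    IsBounded (connectedComponentIn (P.familyImage R)ᶜ x) →
    ∀ v : V, P.pos v ∉ connectedComponentIn (P.familyImage R)ᶜ x

/-- The facial completion: add a clique on the boundary of each bounded face. -/
def facialCompletion (P : PlaneEmbedding G) : SimpleGraph V :=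
  G ⊔ SimpleGraph.fromRel fun u v =>
    ∃ f, P.IsBoundedFace f ∧ u ∈ P.boundaryVerts f ∧ v ∈ P.boundaryVerts f

end PlaneEmbedding

/-- A tree together with a bag of vertices at each node. -/
structure Decomp (V : Type) : Type 1 where
  ι : Type
  tree : SimpleGraph ι
  isTree : tree.IsTree
  bag : ι → Set V

/-- `D` is a tree decomposition of `G`. -/
def IsTreeDecomp {V : Type} (G : SimpleGraph V) (D : Decomp V) : Prop :=
  (∀ v, ∃ i, v ∈ D.bag i) ∧
  (∀ u v, G.Adj u v → ∃ i, u ∈ D.bag i ∧ v ∈ D.bag i) ∧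
  (∀ v, (D.tree.induce {i | v ∈ D.bag i}).Connected)

/-- The treewidth of a graph. -/
noncomputable def treewidth {V : Type} (G : SimpleGraph V) : ℕ :=
  sInf {k | ∃ D : Decomp V, IsTreeDecomp G D ∧ ∀ i, (D.bag i).ncard ≤ k + 1}

/-- `D` is an embedded tree decomposition of the plane graph given by `P`. -/
def IsEmDecomp {V : Type} {G : SimpleGraph V} (P : PlaneEmbedding G)
    (D : Decomp V) : Prop :=
  IsTreeDecomp G D ∧ ∀ f, P.IsBoundedFace f → ∃ i, P.boundaryVerts f ⊆ D.bag i

/-- The em-width of a plane graph. -/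
noncomputable def emwidth {V : Type} {G : SimpleGraph V}
    (P : PlaneEmbedding G) : ℕ :=
  sInf {k | ∃ D : Decomp V, IsEmDecomp P D ∧ ∀ i, (D.bag i).ncard ≤ k + 1}

/-- A cut vertex: its removal disconnects two vertices that were connected. -/
def SimpleGraph.IsCutVertex {V : Type} (G : SimpleGraph V) (u : V) : Prop :=
  ∃ x y, ∃ (hx : x ≠ u) (hy : y ≠ u), G.Reachable x y ∧
    ¬ (G.induce {v | v ≠ u}).Reachable ⟨x, hx⟩ ⟨y, hy⟩

/-- An `r`-family: `r` vertices of degree 2 sharing the same two neighbors. -/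
def IsRFamily {V : Type} (G : SimpleGraph V) (R : Set V) (r : ℕ) : Prop :=
  R.ncard = r ∧ ∃ a b : V, a ≠ b ∧ ∀ v ∈ R, G.neighborSet v = {a, b}


namespace SimpleGraph

/-- Any two vertices of `A` are joined by a walk inside `A`. -/
def WalkConnectedOn {ι : Type} (T : SimpleGraph ι) (A : Set ι) : Prop :=
  ∀ i ∈ A, ∀ j ∈ A, ∃ w : T.Walk i j, ∀ x ∈ w.support, x ∈ A

lemma Walk.IsPath.append_of_forall_eq {ι : Type} {T : SimpleGraph ι} {u v w : ι}
    {p : T.Walk u v} {q : T.Walk v w} (hp : p.IsPath) (hq : q.IsPath)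
    (hpq : ∀ x ∈ p.support, x ∈ q.support → x = v) : (p.append q).IsPath := by
  rw [Walk.isPath_def, Walk.support_append, List.nodup_append']
  have hq' := hq.support_nodup
  refine ⟨hp.support_nodup, hq'.tail, fun x hx hx' => ?_⟩
  have hxv := hpq x hx (List.mem_of_mem_tail hx')
  rw [← q.cons_tail_support] at hq' hx'
  exact (List.nodup_cons.mp hq').1 (hxv ▸ hx')

lemma IsAcyclic.support_subset_of_isPath {ι : Type} {T : SimpleGraph ι} (hT : T.IsAcyclic)
    {u v : ι} {p : T.Walk u v} (hp : p.IsPath) (q : T.Walk u v) : p.support ⊆ q.support := by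
  classical
  have h := (hT.subsingleton_path u v).elim ⟨p, hp⟩ ⟨q.bypass, q.bypass_isPath⟩
  have h' : p = q.bypass := congrArg Subtype.val h
  rw [h']
  exact q.support_bypass_subset_support

lemma IsTree.exists_median {ι : Type} {T : SimpleGraph ι} (hT : T.IsTree) (a b c : ι) :
    ∃ x, (∀ w : T.Walk a b, x ∈ w.support) ∧ (∀ w : T.Walk b c, x ∈ w.support) ∧
      (∀ w : T.Walk a c, x ∈ w.support) := by
  classical
  obtain ⟨p, hp⟩ := (hT.existsUnique_path a b).exists
  obtain ⟨x, hxp, hmin⟩ := p.support.toFinset.exists_min_image (T.dist c) ⟨a, by simp⟩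
  simp only [List.mem_toFinset] at hxp hmin
  obtain ⟨r, hr, hlen⟩ := hT.connected.exists_path_of_dist c x
  have honly : ∀ y ∈ r.support, y ∈ p.support → y = x := by
    intro y hy hyp
    by_contra hne
    have h1 := hmin y hyp
    have h2 := dist_le (r.takeUntil y hy)
    have h3 := r.length_takeUntil_lt_length hy hne
    omega
  obtain ⟨p₁, p₂, hp₁, hp₂, rfl⟩ := hp.mem_support_iff_exists_append.mp hxp
  have hcb : (r.append p₂).IsPath := hr.append_of_forall_eq hp₂ fun y hy hy' =>
    honly y hy (by rw [Walk.mem_support_append_iff]; exact Or.inr hy')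
  have hca : (r.append p₁.reverse).IsPath := hr.append_of_forall_eq hp₁.reverse fun y hy hy' =>
    honly y hy (by rw [Walk.mem_support_append_iff]; left; simpa using hy')
  refine ⟨x, fun w => hT.isAcyclic.support_subset_of_isPath hp w hxp, fun w => ?_, fun w => ?_⟩
  · have := hT.isAcyclic.support_subset_of_isPath hcb w.reverse
      (by rw [Walk.mem_support_append_iff]; exact Or.inl r.end_mem_support)
    simpa using this
  · have := hT.isAcyclic.support_subset_of_isPath hca w.reverse
      (by rw [Walk.mem_support_append_iff]; exact Or.inl r.end_mem_support)
    simpa using this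

lemma IsTree.walkConnectedOn_inter {ι : Type} {T : SimpleGraph ι} (hT : T.IsTree)
    {A B : Set ι} (hA : T.WalkConnectedOn A) (hB : T.WalkConnectedOn B) :
    T.WalkConnectedOn (A ∩ B) := by
  rintro i ⟨hiA, hiB⟩ j ⟨hjA, hjB⟩
  obtain ⟨p, hp⟩ := (hT.existsUnique_path i j).exists
  obtain ⟨v, hv⟩ := hA i hiA j hjA
  obtain ⟨w, hw⟩ := hB i hiB j hjB
  exact ⟨p, fun x hx => ⟨hv x (hT.isAcyclic.support_subset_of_isPath hp v hx),
    hw x (hT.isAcyclic.support_subset_of_isPath hp w hx)⟩⟩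

lemma IsTree.inter_nonempty_of_pairwise {ι : Type} {T : SimpleGraph ι} (hT : T.IsTree)
    {A B C : Set ι} (hA : T.WalkConnectedOn A) (hB : T.WalkConnectedOn B)
    (hC : T.WalkConnectedOn C) (hAB : (A ∩ B).Nonempty) (hBC : (B ∩ C).Nonempty)
    (hAC : (A ∩ C).Nonempty) : (A ∩ B ∩ C).Nonempty := by
  obtain ⟨c, hcA, hcB⟩ := hAB
  obtain ⟨a, haB, haC⟩ := hBC
  obtain ⟨b, hbA, hbC⟩ := hAC
  obtain ⟨x, h₁, h₂, h₃⟩ := hT.exists_median a b c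
  obtain ⟨u, hu⟩ := hC a haC b hbC
  obtain ⟨v, hv⟩ := hA b hbA c hcA
  obtain ⟨w, hw⟩ := hB a haB c hcB
  exact ⟨x, ⟨hv x (h₂ v), hw x (h₃ w)⟩, hu x (h₁ u)⟩

/-- The Helly property for finite families of subtrees of a tree. -/
lemma IsTree.exists_mem_of_pairwise_inter {ι α : Type} {T : SimpleGraph ι} (hT : T.IsTree)
    (s : Finset α) (F : α → Set ι) (hF : ∀ a ∈ s, T.WalkConnectedOn (F a))
    (hpair : ∀ a ∈ s, ∀ b ∈ s, (F a ∩ F b).Nonempty) : ∃ x, ∀ a ∈ s, x ∈ F a := by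
  classical
  induction s using Finset.induction_on generalizing F with
  | empty => exact ⟨hT.connected.nonempty.some, by simp⟩
  | insert a s _ ih =>
    rcases s.eq_empty_or_nonempty with rfl | ⟨c, hc⟩
    · obtain ⟨x, hx, -⟩ := hpair a (by simp) a (by simp)
      exact ⟨x, by simpa using hx⟩
    · have hins : ∀ b ∈ s, b ∈ insert a s := fun b hb => Finset.mem_insert_of_mem hb
      have ha := Finset.mem_insert_self a s
      obtain ⟨x, hx⟩ := ih (fun b => F b ∩ F a)
        (fun b hb => hT.walkConnectedOn_inter (hF b (hins b hb)) (hF a ha))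
        (fun b hb c hc => by
          obtain ⟨x, ⟨hxb, hxc⟩, hxa⟩ := hT.inter_nonempty_of_pairwise (hF b (hins b hb))
            (hF c (hins c hc)) (hF a ha) (hpair b (hins b hb) c (hins c hc))
            (hpair c (hins c hc) a ha) (hpair b (hins b hb) a ha)
          exact ⟨x, ⟨hxb, hxa⟩, hxc, hxa⟩)
      refine ⟨x, fun b hb => ?_⟩
      rcases Finset.mem_insert.mp hb with rfl | hb
      · exact (hx c hc).2
      · exact (hx b hb).1

lemma Connected.walkConnectedOn {ι : Type} {T : SimpleGraph ι} {A : Set ι}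
    (h : (T.induce A).Connected) : T.WalkConnectedOn A := by
  intro i hi j hj
  obtain ⟨w⟩ := h.preconnected ⟨i, hi⟩ ⟨j, hj⟩
  refine ⟨w.map (Embedding.induce A).toHom, fun x hx => ?_⟩
  obtain ⟨y, -, rfl⟩ := List.mem_map.mp ((Walk.support_map _ w) ▸ hx)
  exact y.2

end SimpleGraph

/-- Any two elements of `B` are joined by a chain of `K`-related elements of `B`. -/
def LinkedIn {V : Type} (K : V → V → Prop) (B : Set V) : Prop :=
  ∀ u ∈ B, ∀ v ∈ B, Relation.ReflTransGen (fun x y => x ∈ B ∧ y ∈ B ∧ K x y) u v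

/-- Two vertices sharing a bag. -/
def Decomp.Cobag {V : Type} (D : Decomp V) (u v : V) : Prop :=
  ∃ i, u ∈ D.bag i ∧ v ∈ D.bag i

lemma Decomp.walkConnectedOn_of_linkedIn {V : Type} {D : Decomp V}
    (hD : ∀ v, (D.tree.induce {i | v ∈ D.bag i}).Connected) {B : Set V}
    (hB : LinkedIn D.Cobag B) : D.tree.WalkConnectedOn {i | (D.bag i ∩ B).Nonempty} := by
  rintro i ⟨u, hui, huB⟩ j ⟨v, hvj, hvB⟩
  have key := hB u huB v hvB
  clear hvB
  induction key generalizing j with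
  | refl =>
    obtain ⟨w, hw⟩ := (hD u).walkConnectedOn i hui j hvj
    exact ⟨w, fun x hx => ⟨u, hw x hx, huB⟩⟩
  | tail _ hbc ih =>
    rename_i b c _
    obtain ⟨hb, hc, l, hbl, hcl⟩ := hbc
    obtain ⟨w₁, hw₁⟩ := ih l hbl
    obtain ⟨w₂, hw₂⟩ := (hD c).walkConnectedOn l hcl j hvj
    refine ⟨w₁.append w₂, fun x hx => ?_⟩
    rcases (SimpleGraph.Walk.mem_support_append_iff _ _).mp hx with hx | hx
    · exact hw₁ x hx
    · exact ⟨c, hw₂ x hx, hc⟩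

/-- Some bag of a tree decomposition meets every element of a bramble. -/
lemma Decomp.exists_bag_inter_nonempty {V α : Type} [Finite α] {D : Decomp V}
    (hD : ∀ v, (D.tree.induce {i | v ∈ D.bag i}).Connected) (B : α → Set V)
    (hB : ∀ a, LinkedIn D.Cobag (B a))
    (htouch : ∀ a b, ∃ u ∈ B a, ∃ v ∈ B b, D.Cobag u v) :
    ∃ i, ∀ a, (D.bag i ∩ B a).Nonempty := by
  have := Fintype.ofFinite α
  obtain ⟨i, hi⟩ := D.isTree.exists_mem_of_pairwise_inter Finset.univ
    (fun a => {i | (D.bag i ∩ B a).Nonempty})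
    (fun a _ => D.walkConnectedOn_of_linkedIn hD (hB a)) (fun a _ b _ => by
      obtain ⟨u, hu, v, hv, i, hui, hvi⟩ := htouch a b
      exact ⟨i, ⟨u, hui, hu⟩, v, hvi, hv⟩)
  exact ⟨i, fun a => hi a (Finset.mem_univ a)⟩

/-- Integer coordinates for a block of `m` columns of `h * p + 1` vertices each, together with
part of one further column. -/
structure GridCoords (V : Type) (h p m : ℕ) where
  col : V → ℕ
  row : V → ℕ
  ext : ∀ u v, col u = col v → row u = row v → u = v
  row_le : ∀ u, row u ≤ h * p
  col_le : ∀ u, col u ≤ m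
  surj : ∀ j y, j < m → y ≤ h * p → ∃ u, col u = j ∧ row u = y

namespace GridCoords

variable {V : Type} {h p m : ℕ} (c : GridCoords V h p m)

/-- A set of at most `h * p + h` vertices meeting all rows contains at most one full column of
the first strip. -/
lemma eq_of_full_columns [Finite V] {S : Set V} (hS : S.ncard ≤ h * p + h) (hp : 1 ≤ p)
    (hrow : ∀ y ≤ h * p, ∃ u ∈ S, c.row u = y) {a b : ℕ}
    (ha : ∀ y ≤ h, ∃ u ∈ S, c.col u = a ∧ c.row u = y)
    (hb : ∀ y ≤ h, ∃ u ∈ S, c.col u = b ∧ c.row u = y) : a = b := by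
  classical
  by_contra hab
  have := Fintype.ofFinite V
  have hcard : S.toFinset.card ≤ h * p + h := by rwa [← Set.ncard_eq_toFinset_card']
  have hle : h ≤ h * p := Nat.le_mul_of_pos_right h hp
  have hsum : S.toFinset.card =
      ∑ y ∈ Finset.range (h * p + 1), (S.toFinset.filter fun u => c.row u = y).card :=
    Finset.card_eq_sum_card_fiberwise fun u _ => by
      simpa [Nat.lt_succ_iff] using c.row_le u
  have hbound : ∑ y ∈ Finset.range (h * p + 1), (1 + if y ≤ h then 1 else 0) ≤
      ∑ y ∈ Finset.range (h * p + 1), (S.toFinset.filter fun u => c.row u = y).card := by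
    refine Finset.sum_le_sum fun y hy => ?_
    have hy' : y ≤ h * p := Nat.lt_succ_iff.mp (Finset.mem_range.mp hy)
    split_ifs with hyh
    · obtain ⟨u, huS, hua, huy⟩ := ha y hyh
      obtain ⟨v, hvS, hvb, hvy⟩ := hb y hyh
      have : 1 < (S.toFinset.filter fun u => c.row u = y).card :=
        Finset.one_lt_card.mpr ⟨u, by simp [huS, huy], v, by simp [hvS, hvy], by
          rintro rfl; exact hab (hua.symm.trans hvb)⟩
      omega
    · obtain ⟨u, huS, huy⟩ := hrow y hy'
      exact Finset.card_pos.mpr ⟨u, by simp [huS, huy]⟩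
  have hfilter : (Finset.range (h * p + 1)).filter (· ≤ h) = Finset.range (h + 1) := by
    ext y; simp only [Finset.mem_filter, Finset.mem_range]; omega
  rw [Finset.sum_add_distrib, ← Finset.card_filter, hfilter] at hbound
  simp only [Finset.sum_const, Finset.card_range, smul_eq_mul, mul_one] at hbound
  omega

/-- Among more than `S.ncard` columns, one is disjoint from `S`. -/
lemma exists_clean_column [Finite V] (S : Set V) (a b : ℕ) (hS : S.ncard < b - a) :
    ∃ j, a ≤ j ∧ j < b ∧ ∀ u ∈ S, c.col u ≠ j := by
  classical
  have := Fintype.ofFinite V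
  have hcard : (S.toFinset.image c.col).card < (Finset.Ico a b).card := by
    rw [Nat.card_Ico]
    exact Finset.card_image_le.trans_lt (by rwa [← Set.ncard_eq_toFinset_card'])
  obtain ⟨j, hj, hjS⟩ := Finset.exists_mem_notMem_of_card_lt_card hcard
  rw [Finset.mem_Ico] at hj
  refine ⟨j, hj.1, hj.2, fun u hu huj => hjS ?_⟩
  exact Finset.mem_image.mpr ⟨u, by simpa using hu, huj⟩

/-- The vertices of the first strip in columns `a, …, b - 1` outside `S`. -/
def stripPart (S : Set V) (a b : ℕ) : Set V :=
  {u | a ≤ c.col u ∧ c.col u < b ∧ c.row u ≤ h ∧ u ∉ S}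

/-- The union of the columns and rows disjoint from `S`. -/
def cleanPart (S : Set V) : Set V :=
  {u | c.col u < m ∧ ((∀ v ∈ S, c.col v ≠ c.col u) ∨
    ∀ v ∈ S, c.col v < m → c.row v ≠ c.row u)}

/-- The adjacencies forced by placing every face of the grid in a common bag. -/
structure IsFacial (K : V → V → Prop) : Prop where
  refl : ∀ u, K u u
  symm : ∀ u v, K u v → K v u
  strip : ∀ u v, c.row u ≤ h → c.row v ≤ h → c.col u < m → c.col v < m →
    (c.col u = c.col v ∨ c.col v = c.col u + 1) → K u v
  vert : ∀ u v, c.col u < m → c.col v = c.col u → c.row v = c.row u + 1 → K u v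
  horiz : ∀ u v, c.col v < m → c.col v = c.col u + 1 → c.row v = c.row u → K u v

variable {c} {K : V → V → Prop}

lemma linkedIn_symm (hK : ∀ u v, K u v → K v u) {B : Set V} {u v : V}
    (huv : Relation.ReflTransGen (fun x y => x ∈ B ∧ y ∈ B ∧ K x y) u v) :
    Relation.ReflTransGen (fun x y => x ∈ B ∧ y ∈ B ∧ K x y) v u := by
  induction huv with
  | refl => exact .refl
  | tail _ hbc ih => exact .head ⟨hbc.2.1, hbc.1, hK _ _ hbc.2.2⟩ ih

lemma IsFacial.linkedIn_stripPart (hK : c.IsFacial K) {S : Set V} {a b : ℕ} (hb : b ≤ m)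
    (hfull : ∀ j, a ≤ j → j < b → ∃ u, c.col u = j ∧ c.row u ≤ h ∧ u ∉ S) :
    LinkedIn K (c.stripPart S a b) := by
  have key : ∀ d : ℕ, ∀ u ∈ c.stripPart S a b, ∀ v ∈ c.stripPart S a b, c.col v = c.col u + d →
      Relation.ReflTransGen (fun x y => x ∈ c.stripPart S a b ∧ y ∈ c.stripPart S a b ∧ K x y)
        u v := by
    intro d
    induction d with
    | zero =>
      intro u hu v hv huv
      exact .single ⟨hu, hv, hK.strip u v hu.2.2.1 hv.2.2.1 (hu.2.1.trans_le hb)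
        (hv.2.1.trans_le hb) (Or.inl huv.symm)⟩
    | succ d ih =>
      intro u hu v hv huv
      have hvb := hv.2.1
      have hua := hu.1
      obtain ⟨w, hwc, hwr, hwS⟩ := hfull (c.col u + 1) (by omega) (by omega)
      have hw : w ∈ c.stripPart S a b := ⟨by omega, by omega, hwr, hwS⟩
      exact .head ⟨hu, hw, hK.strip u w hu.2.2.1 hwr (hu.2.1.trans_le hb) (by omega)
        (Or.inr hwc)⟩ (ih w hw v hv (by omega))
  intro u hu v hv
  rcases le_total (c.col u) (c.col v) with huv | huv
  · exact key (c.col v - c.col u) u hu v hv (by omega)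
  · exact linkedIn_symm hK.symm (key (c.col u - c.col v) v hv u hu (by omega))

lemma IsFacial.reflTransGen_column (hK : c.IsFacial K) {B : Set V} {j : ℕ} (hj : j < m)
    (hB : ∀ w, c.col w = j → w ∈ B) {u v : V} (hu : c.col u = j) (hv : c.col v = j) :
    Relation.ReflTransGen (fun x y => x ∈ B ∧ y ∈ B ∧ K x y) u v := by
  have key : ∀ d : ℕ, ∀ u v : V, c.col u = j → c.col v = j → c.row v = c.row u + d →
      Relation.ReflTransGen (fun x y => x ∈ B ∧ y ∈ B ∧ K x y) u v := by
    intro d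
    induction d with
    | zero =>
      intro u v hu hv huv
      rw [c.ext u v (hu.trans hv.symm) huv.symm]
    | succ d ih =>
      intro u v hu hv huv
      have := c.row_le v
      obtain ⟨w, hwc, hwr⟩ := c.surj j (c.row u + 1) hj (by omega)
      exact .head ⟨hB u hu, hB w hwc, hK.vert u w (by omega) (by omega) hwr⟩
        (ih w v hwc hv (by omega))
  rcases le_total (c.row u) (c.row v) with huv | huv
  · exact key (c.row v - c.row u) u v hu hv (by omega)
  · exact linkedIn_symm hK.symm (key (c.row u - c.row v) v u hv hu (by omega))

lemma IsFacial.reflTransGen_row (hK : c.IsFacial K) {B : Set V} {y : ℕ}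
    (hB : ∀ w, c.col w < m → c.row w = y → w ∈ B) {u v : V} (hum : c.col u < m)
    (hvm : c.col v < m) (hu : c.row u = y) (hv : c.row v = y) :
    Relation.ReflTransGen (fun x y => x ∈ B ∧ y ∈ B ∧ K x y) u v := by
  have key : ∀ d : ℕ, ∀ u v : V, c.col v < m → c.row u = y → c.row v = y →
      c.col v = c.col u + d →
      Relation.ReflTransGen (fun x y => x ∈ B ∧ y ∈ B ∧ K x y) u v := by
    intro d
    induction d with
    | zero =>
      intro u v _ hu hv huv
      rw [c.ext u v huv.symm (hu.trans hv.symm)]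
    | succ d ih =>
      intro u v hvm hu hv huv
      have := c.row_le u
      obtain ⟨w, hwc, hwr⟩ := c.surj (c.col u + 1) y (by omega) (by omega)
      exact .head ⟨hB u (by omega) hu, hB w (by omega) hwr,
        hK.horiz u w (by omega) (by omega) (by omega)⟩ (ih w v hvm hwr hv (by omega))
  rcases le_total (c.col u) (c.col v) with huv | huv
  · exact key (c.col v - c.col u) u v hvm hu hv (by omega)
  · exact linkedIn_symm hK.symm (key (c.col u - c.col v) v u hum hv hu (by omega))

lemma IsFacial.linkedIn_cleanPart (hK : c.IsFacial K) {S : Set V} {j y : ℕ} (hj : j < m)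
    (hjS : ∀ v ∈ S, c.col v ≠ j) (hy : y ≤ h * p)
    (hyS : ∀ v ∈ S, c.col v < m → c.row v ≠ y) : LinkedIn K (c.cleanPart S) := by
  obtain ⟨o, hoc, hor⟩ := c.surj j y hj hy
  have hcolumn : ∀ i, (∀ v ∈ S, c.col v ≠ i) → i < m → ∀ w, c.col w = i → w ∈ c.cleanPart S := by
    rintro i hi him w rfl
    exact ⟨him, Or.inl hi⟩
  have hrow : ∀ i, (∀ v ∈ S, c.col v < m → c.row v ≠ i) →
      ∀ w, c.col w < m → c.row w = i → w ∈ c.cleanPart S := by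
    rintro i hi w hw rfl
    exact ⟨hw, Or.inr hi⟩
  have key : ∀ u ∈ c.cleanPart S, Relation.ReflTransGen
      (fun x y => x ∈ c.cleanPart S ∧ y ∈ c.cleanPart S ∧ K x y) u o := by
    rintro u ⟨hum, huS | huS⟩
    · obtain ⟨w, hwc, hwr⟩ := c.surj (c.col u) y hum hy
      exact (hK.reflTransGen_column hum (hcolumn _ huS hum) rfl hwc).trans
        (hK.reflTransGen_row (hrow y hyS) (by omega) (by omega) hwr hor)
    · obtain ⟨w, hwc, hwr⟩ := c.surj j (c.row u) hj (c.row_le u)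
      exact (hK.reflTransGen_row (hrow _ huS) hum (by omega) rfl hwr).trans
        (hK.reflTransGen_column hj (hcolumn j hjS hj) hwc hoc)
  exact fun u hu v hv => (key u hu).trans (linkedIn_symm hK.symm (key v hv))

/-- For `t < m` a threshold column, `c.IsHaven t S B` says that `B` is a piece of the complement
of `S` of one of two kinds: the clean rows and columns, or the first strip between two columns
`a` and `b` on both sides of the threshold, all of whose columns are nonempty. -/
def IsHaven (c : GridCoords V h p m) (t : ℕ) (S B : Set V) : Prop :=
  ((∃ y ≤ h * p, ∀ v ∈ S, c.col v < m → c.row v ≠ y) ∧ B = c.cleanPart S) ∨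
  ∃ a b, (a = 0 ∧ t < b ∨ a ≤ t + 1 ∧ b = m) ∧ b ≤ m ∧ B = c.stripPart S a b ∧
    ∀ j, a ≤ j → j < b → ∃ u, c.col u = j ∧ c.row u ≤ h ∧ u ∉ S

lemma exists_isHaven [Finite V] {S : Set V} (hS : S.ncard ≤ h * p + h) (hp : 1 ≤ p)
    {t : ℕ} (ht : t < m) : ∃ B, c.IsHaven t S B := by
  by_cases hrow : ∃ y ≤ h * p, ∀ v ∈ S, c.col v < m → c.row v ≠ y
  · exact ⟨_, Or.inl ⟨hrow, rfl⟩⟩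
  push Not at hrow
  have hle : h ≤ h * p := Nat.le_mul_of_pos_right h hp
  have hfull : ∀ i < m, (¬ ∃ u, c.col u = i ∧ c.row u ≤ h ∧ u ∉ S) →
      ∀ y ≤ h, ∃ u ∈ S, c.col u = i ∧ c.row u = y := by
    intro i hi hn y hy
    obtain ⟨u, huc, hur⟩ := c.surj i y hi (hy.trans hle)
    by_contra! hcon
    exact hn ⟨u, huc, by omega, fun hu => hcon u hu huc hur⟩
  by_cases hx : ∃ x < m, ¬ ∃ u, c.col u = x ∧ c.row u ≤ h ∧ u ∉ S
  · obtain ⟨x, hxm, hx⟩ := hx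
    have huniq : ∀ j < m, j ≠ x → ∃ u, c.col u = j ∧ c.row u ≤ h ∧ u ∉ S := by
      intro j hj hjx
      by_contra hn
      exact hjx (c.eq_of_full_columns hS hp
        (fun y hy => (hrow y hy).imp fun u hu => ⟨hu.1, hu.2.2⟩)
        (hfull j hj hn) (hfull x hxm hx))
    rcases le_or_gt x t with hxt | hxt
    · exact ⟨_, Or.inr ⟨x + 1, m, Or.inr ⟨by omega, rfl⟩, le_rfl, rfl,
        fun j hj hjm => huniq j hjm (by omega)⟩⟩
    · exact ⟨_, Or.inr ⟨0, x, Or.inl ⟨rfl, hxt⟩, hxm.le, rfl,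
        fun j _ hjx => huniq j (by omega) (by omega)⟩⟩
  · push Not at hx
    exact ⟨_, Or.inr ⟨0, m, Or.inl ⟨rfl, ht⟩, le_rfl, rfl, fun j _ hj => hx j hj⟩⟩

lemma IsHaven.disjoint {t : ℕ} {S B : Set V} (hB : c.IsHaven t S B) : Disjoint S B := by
  rw [Set.disjoint_left]
  intro u hu huB
  rcases hB with ⟨-, rfl⟩ | ⟨a, b, -, -, rfl, -⟩
  · rcases huB with ⟨hum, h' | h'⟩
    · exact h' u hu rfl
    · exact h' u hu hum rfl
  · exact huB.2.2.2 hu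

lemma IsFacial.linkedIn_of_isHaven (hK : c.IsFacial K) {t : ℕ} {S B : Set V}
    (hS : ∃ j, j < m ∧ ∀ u ∈ S, c.col u ≠ j) (hB : c.IsHaven t S B) : LinkedIn K B := by
  rcases hB with ⟨⟨y, hy, hyS⟩, rfl⟩ | ⟨a, b, -, hb, rfl, hfull⟩
  · obtain ⟨j, hj, hjS⟩ := hS
    exact hK.linkedIn_cleanPart hj hjS hy hyS
  · exact hK.linkedIn_stripPart hb hfull

lemma IsFacial.touch_of_isHaven (hK : c.IsFacial K) (hp : 1 ≤ p) {t : ℕ} (ht : t + 1 < m)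
    {S S' B B' : Set V}
    (hSl : ∃ j ≤ t, ∀ u ∈ S, c.col u ≠ j) (hSr : ∃ j, t < j ∧ j < m ∧ ∀ u ∈ S, c.col u ≠ j)
    (hSl' : ∃ j ≤ t, ∀ u ∈ S', c.col u ≠ j) (hSr' : ∃ j, t < j ∧ j < m ∧ ∀ u ∈ S', c.col u ≠ j)
    (hB : c.IsHaven t S B) (hB' : c.IsHaven t S' B') : ∃ u ∈ B, ∃ v ∈ B', K u v := by
  have hle : h ≤ h * p := Nat.le_mul_of_pos_right h hp
  -- a clean part meets every other strip part
  have mixed : ∀ S S' : Set V, (∃ j ≤ t, ∀ u ∈ S, c.col u ≠ j) →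
      (∃ j, t < j ∧ j < m ∧ ∀ u ∈ S, c.col u ≠ j) → ∀ a b,
      (a = 0 ∧ t < b ∨ a ≤ t + 1 ∧ b = m) → b ≤ m →
      (∀ j, a ≤ j → j < b → ∃ u, c.col u = j ∧ c.row u ≤ h ∧ u ∉ S') →
      ∃ u ∈ c.cleanPart S, u ∈ c.stripPart S' a b := by
    rintro S S' ⟨i, hit, hiS⟩ ⟨j, htj, hjm, hjS⟩ a b hab hbm hfull
    rcases hab with ⟨rfl, htb⟩ | ⟨hat, rfl⟩
    · obtain ⟨u, rfl, hur, huS⟩ := hfull i (by omega) (by omega)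
      exact ⟨u, ⟨by omega, Or.inl hiS⟩, by omega, by omega, hur, huS⟩
    · obtain ⟨u, rfl, hur, huS⟩ := hfull j (by omega) (by omega)
      exact ⟨u, ⟨by omega, Or.inl hjS⟩, by omega, by omega, hur, huS⟩
  rcases hB with ⟨⟨y, hy, hyS⟩, rfl⟩ | ⟨a, b, hab, hb, rfl, hfull⟩
  · rcases hB' with ⟨-, rfl⟩ | ⟨a', b', hab', hb', rfl, hfull'⟩
    · obtain ⟨j, hjt, hjS⟩ := hSl'
      obtain ⟨u, rfl, rfl⟩ := c.surj j y (by omega) hy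
      exact ⟨u, ⟨by omega, Or.inr hyS⟩, u, ⟨by omega, Or.inl hjS⟩, hK.refl u⟩
    · obtain ⟨u, hu, hu'⟩ := mixed S S' hSl hSr a' b' hab' hb' hfull'
      exact ⟨u, hu, u, hu', hK.refl u⟩
  · rcases hB' with ⟨-, rfl⟩ | ⟨a', b', hab', hb', rfl, hfull'⟩
    · obtain ⟨u, hu, hu'⟩ := mixed S' S hSl' hSr' a b hab hb hfull
      exact ⟨u, hu', u, hu, hK.refl u⟩
    · obtain ⟨i, i', hai, hib, hai', hib', hii⟩ : ∃ i i', a ≤ i ∧ i < b ∧ a' ≤ i' ∧ i' < b' ∧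
          (i = i' ∨ i' = i + 1 ∨ i = i' + 1) := by
        rcases hab with hab | hab <;> rcases hab' with hab' | hab'
        · exact ⟨0, 0, by omega⟩
        · exact ⟨t, t + 1, by omega⟩
        · exact ⟨t + 1, t, by omega⟩
        · exact ⟨t + 1, t + 1, by omega⟩
      obtain ⟨u, rfl, hur, huS⟩ := hfull i hai hib
      obtain ⟨v, rfl, hvr, hvS⟩ := hfull' i' hai' hib'
      refine ⟨u, ⟨hai, hib, hur, huS⟩, v, ⟨hai', hib', hvr, hvS⟩, ?_⟩
      rcases hii with hii | hii | hii
      · exact hK.strip u v hur hvr (by omega) (by omega) (Or.inl hii)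
      · exact hK.strip u v hur hvr (by omega) (by omega) (Or.inr hii)
      · exact hK.symm _ _ (hK.strip v u hvr hur (by omega) (by omega) (Or.inr hii))

/-- A tree decomposition in which the faces of the grid are contained in bags has a bag with
more than `h * p + h` vertices. -/
lemma exists_lt_ncard_bag [Finite V] {D : Decomp V}
    (hD : ∀ v, (D.tree.induce {i | v ∈ D.bag i}).Connected) (hK : c.IsFacial D.Cobag)
    (hp : 1 ≤ p) (hm : 2 * (h * p + h + 1) ≤ m) : ∃ i, h * p + h < (D.bag i).ncard := by
  by_contra! hcon
  set t := h * p + h with ht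
  have hleft : ∀ S : Set V, S.ncard ≤ t → ∃ j ≤ t, ∀ u ∈ S, c.col u ≠ j := fun S hS => by
    obtain ⟨j, -, hj, hjS⟩ := c.exists_clean_column S 0 (t + 1) (by omega)
    exact ⟨j, by omega, hjS⟩
  have hright : ∀ S : Set V, S.ncard ≤ t → ∃ j, t < j ∧ j < m ∧ ∀ u ∈ S, c.col u ≠ j :=
    fun S hS => by
      obtain ⟨j, hjt, hj, hjS⟩ := c.exists_clean_column S (t + 1) m (by omega)
      exact ⟨j, by omega, hj, hjS⟩
  have hclean : ∀ S : Set V, S.ncard ≤ t → ∃ j, j < m ∧ ∀ u ∈ S, c.col u ≠ j := fun S hS =>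
    (hright S hS).imp fun j hj => hj.2
  have hex : ∀ S : {S : Set V // S.ncard ≤ t}, ∃ B, c.IsHaven t S.1 B := fun S =>
    exists_isHaven S.2 hp (by omega)
  choose B hB using hex
  obtain ⟨i, hi⟩ := Decomp.exists_bag_inter_nonempty hD B
    (fun S => hK.linkedIn_of_isHaven (hclean S.1 S.2) (hB S))
    (fun S S' => hK.touch_of_isHaven hp (by omega) (hleft S.1 S.2) (hright S.1 S.2)
      (hleft S'.1 S'.2) (hright S'.1 S'.2) (hB S) (hB S'))
  exact Set.not_disjoint_iff_nonempty_inter.mpr (hi ⟨D.bag i, hcon i⟩)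
    (hB ⟨D.bag i, hcon i⟩).disjoint

end GridCoords

lemma mem_segment_vertical_iff {a b x : ℝ × ℝ} (h₁ : b.1 = a.1) (h₂ : b.2 = a.2 + 1) :
    x ∈ segment ℝ a b ↔ x.1 = a.1 ∧ a.2 ≤ x.2 ∧ x.2 ≤ a.2 + 1 := by
  rw [segment_eq_image']
  constructor
  · rintro ⟨t, ⟨ht₀, ht₁⟩, rfl⟩
    simp only [Prod.fst_add, Prod.smul_fst, Prod.fst_sub, h₁, Prod.snd_add, Prod.smul_snd,
      Prod.snd_sub, h₂, smul_eq_mul]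
    exact ⟨by ring, by linarith, by linarith⟩
  · rintro ⟨hx, h₃, h₄⟩
    refine ⟨x.2 - a.2, ⟨by linarith, by linarith⟩, Prod.ext ?_ ?_⟩
    · simp [h₁, hx]
    · simp [h₂]

lemma mem_segment_horizontal_iff {a b x : ℝ × ℝ} (h₁ : b.1 = a.1 + 1) (h₂ : b.2 = a.2) :
    x ∈ segment ℝ a b ↔ x.2 = a.2 ∧ a.1 ≤ x.1 ∧ x.1 ≤ a.1 + 1 := by
  rw [segment_eq_image']
  constructor
  · rintro ⟨t, ⟨ht₀, ht₁⟩, rfl⟩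
    simp only [Prod.fst_add, Prod.smul_fst, Prod.fst_sub, h₁, Prod.snd_add, Prod.smul_snd,
      Prod.snd_sub, h₂, smul_eq_mul]
    exact ⟨by ring, by linarith, by linarith⟩
  · rintro ⟨hx, h₃, h₄⟩
    refine ⟨x.1 - a.1, ⟨by linarith, by linarith⟩, Prod.ext ?_ ?_⟩
    · simp [h₁]
    · simp [h₂, hx]

namespace GridCoords

variable {V : Type} {h p m : ℕ} (c : GridCoords V h p m)

/-- `v` is the upper neighbour of `u`, or the right neighbour of `u` in a row whose index is a
multiple of `h`. -/
def Step (u v : V) : Prop :=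
  c.col v < m ∧ ((c.col v = c.col u ∧ c.row v = c.row u + 1) ∨
    (c.col v = c.col u + 1 ∧ c.row v = c.row u ∧ h ∣ c.row u))

/-- The grid with columns of unit edges and with horizontal edges in every `h`-th row; the
vertices of the last, partial column are isolated. -/
def graph : SimpleGraph V where
  Adj u v := c.Step u v ∨ c.Step v u
  symm := ⟨fun _ _ => Or.symm⟩
  loopless := ⟨fun u hu => by rcases hu with ⟨-, hu⟩ | ⟨-, hu⟩ <;> omega⟩

/-- The point of the plane with the given coordinates. -/
def point (u : V) : ℝ × ℝ := (c.col u, c.row u)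

lemma point_injective : Function.Injective c.point := by
  intro u v huv
  simp only [point, Prod.mk.injEq, Nat.cast_inj] at huv
  exact c.ext u v huv.1 huv.2

/-- The straight line segment representing an edge. -/
def edgeArc (e : Sym2 V) : Set (ℝ × ℝ) := convexHull ℝ (c.point '' {w | w ∈ e})

lemma edgeArc_mk (u v : V) : c.edgeArc s(u, v) = segment ℝ (c.point u) (c.point v) := by
  have : {w | w ∈ s(u, v)} = ({u, v} : Set V) := by ext; simp
  rw [edgeArc, this, Set.image_pair, convexHull_pair]

lemma exists_step_of_mem_edgeSet {e : Sym2 V} (he : e ∈ c.graph.edgeSet) :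
    ∃ u v, e = s(u, v) ∧ c.Step u v := by
  induction e using Sym2.ind with
  | _ u v =>
    rcases he with he | he
    · exact ⟨u, v, rfl, he⟩
    · exact ⟨v, u, Sym2.eq_swap, he⟩

lemma mem_edgeArc_vertical {u v : V} {x : ℝ × ℝ} (h₁ : c.col v = c.col u)
    (h₂ : c.row v = c.row u + 1) :
    x ∈ c.edgeArc s(u, v) ↔ x.1 = c.col u ∧ (c.row u : ℝ) ≤ x.2 ∧ x.2 ≤ c.row u + 1 := by
  rw [edgeArc_mk, mem_segment_vertical_iff] <;> simp [point, h₁, h₂]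

lemma mem_edgeArc_horizontal {u v : V} {x : ℝ × ℝ} (h₁ : c.col v = c.col u + 1)
    (h₂ : c.row v = c.row u) :
    x ∈ c.edgeArc s(u, v) ↔ x.2 = c.row u ∧ (c.col u : ℝ) ≤ x.1 ∧ x.1 ≤ c.col u + 1 := by
  rw [edgeArc_mk, mem_segment_horizontal_iff] <;> simp [point, h₁, h₂]

/-- Lattice points on edges are endpoints. -/
lemma exists_mem_of_natCast_mem_edgeArc {e : Sym2 V} (he : e ∈ c.graph.edgeSet) {i j : ℕ}
    (hx : ((i : ℝ), (j : ℝ)) ∈ c.edgeArc e) : ∃ w ∈ e, c.col w = i ∧ c.row w = j := by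
  obtain ⟨u, v, rfl, -, ⟨h₁, h₂⟩ | ⟨h₁, h₂, -⟩⟩ := c.exists_step_of_mem_edgeSet he
  · rw [c.mem_edgeArc_vertical h₁ h₂] at hx
    dsimp only at hx
    norm_cast at hx
    rcases Nat.eq_or_lt_of_le hx.2.1 with hj | hj
    · exact ⟨u, by simp, by omega, by omega⟩
    · exact ⟨v, by simp, by omega, by omega⟩
  · rw [c.mem_edgeArc_horizontal h₁ h₂] at hx
    dsimp only at hx
    norm_cast at hx
    rcases Nat.eq_or_lt_of_le hx.2.1 with hj | hj
    · exact ⟨u, by simp, by omega, by omega⟩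
    · exact ⟨v, by simp, by omega, by omega⟩

lemma eq_natCast_of_mem_Icc {a b : ℕ} (hab : a ≠ b) {x : ℝ} (ha : (a : ℝ) ≤ x)
    (ha' : x ≤ a + 1) (hb : (b : ℝ) ≤ x) (hb' : x ≤ b + 1) : ∃ j : ℕ, x = j := by
  rcases Nat.lt_or_gt_of_ne hab with hlt | hlt
  · have : (a : ℝ) + 1 ≤ b := by exact_mod_cast hlt
    exact ⟨b, by linarith⟩
  · have : (b : ℝ) + 1 ≤ a := by exact_mod_cast hlt
    exact ⟨a, by linarith⟩

/-- Distinct edges meet only in lattice points. -/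
lemma exists_natCast_of_mem_edgeArc {e f : Sym2 V} (he : e ∈ c.graph.edgeSet)
    (hf : f ∈ c.graph.edgeSet) (hef : e ≠ f) {x : ℝ × ℝ} (hxe : x ∈ c.edgeArc e)
    (hxf : x ∈ c.edgeArc f) : ∃ i j : ℕ, x = ((i : ℝ), (j : ℝ)) := by
  obtain ⟨u, v, rfl, -, ⟨h₁, h₂⟩ | ⟨h₁, h₂, -⟩⟩ := c.exists_step_of_mem_edgeSet he <;>
  obtain ⟨u', v', rfl, -, ⟨h₁', h₂'⟩ | ⟨h₁', h₂', -⟩⟩ := c.exists_step_of_mem_edgeSet hf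
  · rw [c.mem_edgeArc_vertical h₁ h₂] at hxe
    rw [c.mem_edgeArc_vertical h₁' h₂'] at hxf
    have hcol : c.col u = c.col u' := by exact_mod_cast hxe.1.symm.trans hxf.1
    have hrow : c.row u ≠ c.row u' := fun hrow => hef (by
      rw [c.ext u u' hcol hrow, c.ext v v' (by omega) (by omega)])
    obtain ⟨j, hj⟩ := eq_natCast_of_mem_Icc hrow hxe.2.1 hxe.2.2 hxf.2.1 hxf.2.2
    exact ⟨c.col u, j, Prod.ext hxe.1 hj⟩
  · rw [c.mem_edgeArc_vertical h₁ h₂] at hxe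
    rw [c.mem_edgeArc_horizontal h₁' h₂'] at hxf
    exact ⟨c.col u, c.row u', Prod.ext hxe.1 hxf.1⟩
  · rw [c.mem_edgeArc_horizontal h₁ h₂] at hxe
    rw [c.mem_edgeArc_vertical h₁' h₂'] at hxf
    exact ⟨c.col u', c.row u, Prod.ext hxf.1 hxe.1⟩
  · rw [c.mem_edgeArc_horizontal h₁ h₂] at hxe
    rw [c.mem_edgeArc_horizontal h₁' h₂'] at hxf
    have hrow : c.row u = c.row u' := by exact_mod_cast hxe.1.symm.trans hxf.1
    have hcol : c.col u ≠ c.col u' := fun hcol => hef (by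
      rw [c.ext u u' hcol hrow, c.ext v v' (by omega) (by omega)])
    obtain ⟨i, hi⟩ := eq_natCast_of_mem_Icc hcol hxe.2.1 hxe.2.2 hxf.2.1 hxf.2.2
    exact ⟨i, c.row u, Prod.ext hi hxe.1⟩

/-- The straight line embedding of the grid. -/
def embedding : PlaneEmbedding c.graph where
  pos := c.point
  pos_inj := c.point_injective
  arc e := c.edgeArc e
  arc_path e := by
    obtain ⟨u, v, huv, hstep⟩ := c.exists_step_of_mem_edgeSet e.2
    refine ⟨u, v, huv, Path.segment _ _, Path.segment_injective_of_ne ?_, ?_⟩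
    · exact c.point_injective.ne (c.graph.ne_of_adj (Or.inl hstep))
    · rw [Path.range_segment, huv, edgeArc_mk]
  arc_avoid e w hw := by
    obtain ⟨v, hve, hcol, hrow⟩ := c.exists_mem_of_natCast_mem_edgeArc e.2 hw
    rwa [← c.ext v w hcol hrow]
  arc_inter e f hef x hx := by
    obtain ⟨i, j, rfl⟩ := c.exists_natCast_of_mem_edgeArc e.2 f.2
      (fun h => hef (Subtype.ext h)) hx.1 hx.2
    obtain ⟨v, hve, hvi, hvj⟩ := c.exists_mem_of_natCast_mem_edgeArc e.2 hx.1
    obtain ⟨w, hwf, hwi, hwj⟩ := c.exists_mem_of_natCast_mem_edgeArc f.2 hx.2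
    obtain rfl := c.ext v w (hvi.trans hwi.symm) (hvj.trans hwj.symm)
    exact ⟨v, hve, hwf, by rw [← hvi, ← hvj]; rfl⟩

end GridCoords

lemma not_isBounded_prod_of_left {A B : Set ℝ} (hA : ¬ IsBounded A) (hB : B.Nonempty) :
    ¬ IsBounded (A ×ˢ B) := fun h => hA <| by
  rw [← Set.fst_image_prod A hB]
  exact h.image_fst

lemma not_isBounded_prod_of_right {A B : Set ℝ} (hA : A.Nonempty) (hB : ¬ IsBounded B) :
    ¬ IsBounded (A ×ˢ B) := fun h => hB <| by
  rw [← Set.snd_image_prod hA B]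
  exact h.image_snd

lemma not_isBounded_Iio (a : ℝ) : ¬ IsBounded (Iio a) := fun h => not_bddBelow_Iio a h.bddBelow

lemma not_isBounded_Ioi (a : ℝ) : ¬ IsBounded (Ioi a) := fun h => not_bddAbove_Ioi a h.bddAbove

lemma not_isBounded_Ici (a : ℝ) : ¬ IsBounded (Ici a) := fun h => not_bddAbove_Ici a h.bddAbove

lemma not_isBounded_connectedComponentIn {F W : Set (ℝ × ℝ)} {x : ℝ × ℝ} (hW : Convex ℝ W)
    (hub : ¬ IsBounded W) (hWF : Disjoint W F) (hx : x ∈ W) :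
    ¬ IsBounded (connectedComponentIn Fᶜ x) := fun h =>
  hub (h.subset (hW.isPreconnected.subset_connectedComponentIn hx hWF.subset_compl_right))

/-- A vertex in the closure of an unbounded convex region avoiding the drawing is an outer
vertex. -/
lemma PlaneEmbedding.mem_outerVerts {V : Type} {G : SimpleGraph V} (P : PlaneEmbedding G)
    {S : Set V} {W : Set (ℝ × ℝ)} (hW : Convex ℝ W) (hub : ¬ IsBounded W)
    (hWS : Disjoint W (P.subImage S)) {v : V} (hv : v ∈ S) (hvW : P.pos v ∈ closure W) :
    v ∈ P.outerVerts S := by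
  obtain ⟨x, hx⟩ : W.Nonempty := closure_nonempty_iff.mp ⟨_, hvW⟩
  exact ⟨hv, x, hWS.notMem_of_mem_left hx, not_isBounded_connectedComponentIn hW hub hWS hx,
    closure_mono (hW.isPreconnected.subset_connectedComponentIn hx hWS.subset_compl_right) hvW⟩

namespace GridCoords

variable {V : Type} {h p m : ℕ} (c : GridCoords V h p m)

/-- The vertices left after removing `t` layers from below and from above. -/
def layerCore (t : ℕ) : Set V :=
  {u | h * t < c.row u + h ∧ c.row u + h * t < h * p + h}

lemma eq_natCast_or_mem_edgeArc_of_mem_subImage {S : Set V} {x : ℝ × ℝ}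
    (hx : x ∈ c.embedding.subImage S) : (∃ i : ℕ, x.1 = i) ∨
      ∃ u ∈ S, h ∣ c.row u ∧ x.2 = c.row u := by
  rcases hx with ⟨u, hu, rfl⟩ | hx
  · exact Or.inl ⟨c.col u, rfl⟩
  · simp only [Set.mem_iUnion] at hx
    obtain ⟨⟨e, he⟩, heS, hx⟩ := hx
    change x ∈ c.edgeArc e at hx
    obtain ⟨u, v, rfl, -, ⟨h₁, h₂⟩ | ⟨h₁, h₂, h₃⟩⟩ := c.exists_step_of_mem_edgeSet he
    · rw [c.mem_edgeArc_vertical h₁ h₂] at hx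
      exact Or.inl ⟨_, hx.1⟩
    · rw [c.mem_edgeArc_horizontal h₁ h₂] at hx
      exact Or.inr ⟨u, heS u (by simp), h₃, hx.1⟩

lemma notMem_Ioo_natCast (i j : ℕ) : (i : ℝ) ∉ Ioo (j : ℝ) (j + 1) := by
  rintro ⟨h₁, h₂⟩
  norm_cast at h₁ h₂
  omega

lemma peel_subset_layerCore {S : Set V} {t : ℕ} (hS : S ⊆ c.layerCore t) :
    c.embedding.peel S ⊆ c.layerCore (t + 1) := by
  rintro v ⟨hvS, hv⟩
  by_contra hcon
  apply hv
  have hcol : (c.col v : ℝ) ∈ closure (Ioo (c.col v : ℝ) (c.col v + 1)) := by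
    rw [closure_Ioo (by simp)]; simp
  have hne : (Ioo (c.col v : ℝ) (c.col v + 1)).Nonempty := nonempty_Ioo.mpr (by simp)
  have hcase : c.row v ≤ h * t ∨ h * p ≤ c.row v + h * t := by
    simp only [layerCore, Set.mem_ofPred_eq, mul_add, mul_one] at hcon
    omega
  rcases hcase with hrow | hrow
  · refine c.embedding.mem_outerVerts (W := Ioo (c.col v : ℝ) (c.col v + 1) ×ˢ Iio (c.row v : ℝ))
      ((convex_Ioo _ _).prod (convex_Iio _))
      (not_isBounded_prod_of_right hne (not_isBounded_Iio _)) ?_ hvS ?_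
    · rw [Set.disjoint_left]
      rintro x ⟨hx₁, hx₂⟩ hx
      rcases c.eq_natCast_or_mem_edgeArc_of_mem_subImage hx with ⟨i, hi⟩ | ⟨u, hu, ⟨i, hi⟩, hxu⟩
      · exact notMem_Ioo_natCast _ _ (hi ▸ hx₁)
      · rw [Set.mem_Iio, hxu, Nat.cast_lt] at hx₂
        have h₁ := (hS hu).1
        rw [hi] at h₁ hx₂
        have h₂ : t < i + 1 := lt_of_mul_lt_mul_left (by rw [mul_add, mul_one]; exact h₁)
          (Nat.zero_le h)
        have h₃ := Nat.mul_le_mul_left h (Nat.lt_succ_iff.mp h₂)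
        omega
    · rw [closure_prod_eq, closure_Iio]
      exact ⟨hcol, le_refl (c.row v : ℝ)⟩
  · refine c.embedding.mem_outerVerts (W := Ioo (c.col v : ℝ) (c.col v + 1) ×ˢ Ioi (c.row v : ℝ))
      ((convex_Ioo _ _).prod (convex_Ioi _))
      (not_isBounded_prod_of_right hne (not_isBounded_Ioi _)) ?_ hvS ?_
    · rw [Set.disjoint_left]
      rintro x ⟨hx₁, hx₂⟩ hx
      rcases c.eq_natCast_or_mem_edgeArc_of_mem_subImage hx with ⟨i, hi⟩ | ⟨u, hu, ⟨i, hi⟩, hxu⟩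
      · exact notMem_Ioo_natCast _ _ (hi ▸ hx₁)
      · rw [Set.mem_Ioi, hxu, Nat.cast_lt] at hx₂
        have h₁ := (hS hu).2
        rw [hi] at h₁ hx₂
        have h₂ : i + t < p + 1 := lt_of_mul_lt_mul_left
          (by rw [mul_add, mul_add, mul_one]; exact h₁) (Nat.zero_le h)
        have h₃ := Nat.mul_le_mul_left h (Nat.lt_succ_iff.mp h₂)
        rw [mul_add] at h₃
        omega
    · rw [closure_prod_eq, closure_Ioi]
      exact ⟨hcol, le_refl (c.row v : ℝ)⟩

lemma outerplanarAtMost (hh : 0 < h) {k : ℕ} (hk : p + 2 ≤ 2 * k) :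
    c.embedding.OuterplanarAtMost k := by
  have key : ∀ t, (c.embedding.peel)^[t] Set.univ ⊆ c.layerCore t := by
    intro t
    induction t with
    | zero =>
      intro u _
      have := c.row_le u
      simp only [layerCore, Set.mem_ofPred_eq]
      omega
    | succ t ih =>
      rw [Function.iterate_succ_apply']
      exact c.peel_subset_layerCore ih
  refine Set.eq_empty_of_subset_empty ((key k).trans ?_)
  rintro u ⟨h₁, h₂⟩
  have := Nat.mul_le_mul_left h hk
  rw [mul_add] at this
  have h₃ : h * (2 * k) = h * k + h * k := by ring
  omega

/-- The open rectangle between two consecutive columns and two consecutive full rows. -/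
def cell (_ : GridCoords V h p m) (j i : ℕ) : Set (ℝ × ℝ) :=
  Ioo (j : ℝ) (j + 1) ×ˢ Ioo ((h * i : ℕ) : ℝ) ((h * (i + 1) : ℕ) : ℝ)

lemma image_eq_subImage : c.embedding.image = c.embedding.subImage Set.univ := by
  simp [PlaneEmbedding.image, PlaneEmbedding.subImage]

lemma bounds_of_mem_image {x : ℝ × ℝ} (hx : x ∈ c.embedding.image) :
    0 ≤ x.1 ∧ (x.1 + 1 ≤ m ∨ x.1 = m) ∧ 0 ≤ x.2 ∧ x.2 ≤ (h * p : ℕ) := by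
  rcases hx with ⟨u, rfl⟩ | hx
  · refine ⟨Nat.cast_nonneg _, ?_, Nat.cast_nonneg _, Nat.cast_le.mpr (c.row_le u)⟩
    rcases (c.col_le u).lt_or_eq with hu | hu
    · left
      change (c.col u : ℝ) + 1 ≤ m
      exact_mod_cast hu
    · right
      change (c.col u : ℝ) = m
      exact_mod_cast hu
  · simp only [Set.mem_iUnion] at hx
    obtain ⟨⟨e, he⟩, hx⟩ := hx
    change x ∈ c.edgeArc e at hx
    obtain ⟨u, v, rfl, hvm, ⟨h₁, h₂⟩ | ⟨h₁, h₂, h₃⟩⟩ := c.exists_step_of_mem_edgeSet he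
    · rw [c.mem_edgeArc_vertical h₁ h₂] at hx
      have hv : (c.col u : ℝ) + 1 ≤ m := by exact_mod_cast h₁ ▸ hvm
      have hr : (c.row u : ℝ) + 1 ≤ (h * p : ℕ) := by exact_mod_cast h₂ ▸ c.row_le v
      have h₀ : (0 : ℝ) ≤ c.row u := Nat.cast_nonneg _
      exact ⟨hx.1 ▸ Nat.cast_nonneg _, Or.inl (by linarith), by linarith, by linarith⟩
    · rw [c.mem_edgeArc_horizontal h₁ h₂] at hx
      have hv : (c.col u : ℝ) + 1 + 1 ≤ m := by exact_mod_cast h₁ ▸ hvm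
      have hr : (c.row u : ℝ) ≤ (h * p : ℕ) := by exact_mod_cast c.row_le u
      have h₀ : (0 : ℝ) ≤ c.col u := Nat.cast_nonneg _
      exact ⟨by linarith, Or.inl (by linarith), hx.1 ▸ Nat.cast_nonneg _, by linarith⟩

lemma disjoint_cell_image (j i : ℕ) : Disjoint (c.cell j i) c.embedding.image := by
  rw [Set.disjoint_left, image_eq_subImage]
  rintro x ⟨hx₁, hx₂⟩ hx
  rcases c.eq_natCast_or_mem_edgeArc_of_mem_subImage hx with ⟨a, ha⟩ | ⟨u, -, ⟨a, ha⟩, hxu⟩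
  · exact notMem_Ioo_natCast _ _ (ha ▸ hx₁)
  · rw [hxu, ha] at hx₂
    have h₁ := lt_of_mul_lt_mul_left (Nat.cast_lt.mp hx₂.1) (Nat.zero_le h)
    have h₂ := lt_of_mul_lt_mul_left (Nat.cast_lt.mp hx₂.2) (Nat.zero_le h)
    omega

lemma edgeArc_subset_image {e : Sym2 V} (he : e ∈ c.graph.edgeSet) :
    c.edgeArc e ⊆ c.embedding.image := fun _ hx =>
  Or.inr (Set.mem_iUnion.mpr ⟨⟨e, he⟩, hx⟩)

lemma mem_image_of_column {x : ℝ × ℝ} {j : ℕ} (hj : j < m) (hx : x.1 = j) (h₀ : 0 ≤ x.2)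
    (h₁ : x.2 ≤ (h * p : ℕ)) : x ∈ c.embedding.image := by
  have hfl := Nat.floor_le h₀
  have hlt := Nat.lt_floor_add_one x.2
  obtain hy | hy := (Nat.floor_le_of_le h₁).lt_or_eq
  · obtain ⟨u, hu, hu'⟩ := c.surj j ⌊x.2⌋₊ hj hy.le
    obtain ⟨v, hv, hv'⟩ := c.surj j (⌊x.2⌋₊ + 1) hj hy
    have hstep : c.Step u v := ⟨by omega, Or.inl (by omega)⟩
    refine c.edgeArc_subset_image (show s(u, v) ∈ c.graph.edgeSet from Or.inl hstep) ?_
    rw [c.mem_edgeArc_vertical (by omega) (by omega), hu, hu']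
    exact ⟨hx, hfl, hlt.le⟩
  · obtain ⟨u, hu, hu'⟩ := c.surj j (h * p) hj le_rfl
    refine Or.inl ⟨u, Prod.ext ?_ ?_⟩
    · exact (congrArg Nat.cast hu).trans hx.symm
    · rw [hy] at hfl
      exact (congrArg Nat.cast hu').trans (le_antisymm hfl h₁)

lemma mem_image_of_row {x : ℝ × ℝ} {i : ℕ} (hi : i ≤ p) (hx : x.2 = (h * i : ℕ))
    (h₀ : 0 ≤ x.1) (h₁ : x.1 + 1 ≤ m) : x ∈ c.embedding.image := by
  have hle : h * i ≤ h * p := Nat.mul_le_mul_left h hi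
  have hfl := Nat.floor_le h₀
  have hlt := Nat.lt_floor_add_one x.1
  have hfm : ⌊x.1⌋₊ + 1 ≤ m := by
    have : (⌊x.1⌋₊ : ℝ) + 1 ≤ m := by linarith
    exact_mod_cast this
  obtain hy | hy := hfm.lt_or_eq
  · obtain ⟨u, hu, hu'⟩ := c.surj ⌊x.1⌋₊ (h * i) (by omega) hle
    obtain ⟨v, hv, hv'⟩ := c.surj (⌊x.1⌋₊ + 1) (h * i) hy hle
    have hstep : c.Step u v :=
      ⟨by omega, Or.inr ⟨by omega, by omega, hu' ▸ dvd_mul_right h i⟩⟩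
    refine c.edgeArc_subset_image (show s(u, v) ∈ c.graph.edgeSet from Or.inl hstep) ?_
    rw [c.mem_edgeArc_horizontal (by omega) (by omega), hu, hu']
    exact ⟨hx, hfl, hlt.le⟩
  · obtain ⟨u, hu, hu'⟩ := c.surj ⌊x.1⌋₊ (h * i) (by omega) hle
    refine Or.inl ⟨u, Prod.ext ?_ ?_⟩
    · refine (congrArg Nat.cast hu).trans (le_antisymm hfl ?_)
      have : (⌊x.1⌋₊ : ℝ) + 1 = m := by exact_mod_cast hy
      linarith
    · exact (congrArg Nat.cast hu').trans hx.symm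

lemma closure_cell (hh : 0 < h) (j i : ℕ) : closure (c.cell j i) =
    Icc (j : ℝ) (j + 1) ×ˢ Icc ((h * i : ℕ) : ℝ) ((h * (i + 1) : ℕ) : ℝ) := by
  rw [cell, closure_prod_eq, closure_Ioo (by simp), closure_Ioo]
  exact Nat.cast_injective.ne (by rw [mul_add]; omega)

lemma mem_image_of_mem_closure_cell (hh : 0 < h) {j i : ℕ} (hj : j + 1 < m) (hi : i < p)
    {x : ℝ × ℝ} (hx : x ∈ closure (c.cell j i)) (hxc : x ∉ c.cell j i) :
    x ∈ c.embedding.image := by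
  rw [c.closure_cell hh] at hx
  obtain ⟨⟨h₁, h₂⟩, h₃, h₄⟩ := hx
  have hle : ((h * (i + 1) : ℕ) : ℝ) ≤ (h * p : ℕ) :=
    Nat.cast_le.mpr (Nat.mul_le_mul_left h hi)
  have hj0 : (0 : ℝ) ≤ j := Nat.cast_nonneg j
  have hi0 : (0 : ℝ) ≤ (h * i : ℕ) := Nat.cast_nonneg _
  have hjm : (j : ℝ) + 1 + 1 ≤ m := by exact_mod_cast hj
  rcases h₁.eq_or_lt with h₁ | h₁
  · exact c.mem_image_of_column (by omega) h₁.symm (by linarith) (by linarith)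
  rcases h₂.eq_or_lt with h₂ | h₂
  · exact c.mem_image_of_column hj (by rw [h₂]; push_cast; rfl) (by linarith) (by linarith)
  rcases h₃.eq_or_lt with h₃ | h₃
  · exact c.mem_image_of_row hi.le h₃.symm (by linarith) (by linarith)
  rcases h₄.eq_or_lt with h₄ | h₄
  · exact c.mem_image_of_row (i := i + 1) hi h₄ (by linarith) (by linarith)
  · exact absurd ⟨⟨h₁, h₂⟩, h₃, h₄⟩ hxc

lemma connectedComponentIn_eq_cell (hh : 0 < h) {j i : ℕ} (hj : j + 1 < m) (hi : i < p)
    {x : ℝ × ℝ} (hx : x ∈ c.cell j i) :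
    connectedComponentIn (c.embedding.image)ᶜ x = c.cell j i := by
  have hsub := (c.disjoint_cell_image j i).subset_compl_right
  apply Set.Subset.antisymm
  · refine isPreconnected_connectedComponentIn.subset_left_of_subset_union
      (v := (closure (c.cell j i))ᶜ) (isOpen_Ioo.prod isOpen_Ioo) isClosed_closure.isOpen_compl
      (Set.disjoint_compl_right_iff_subset.mpr subset_closure) ?_
      ⟨x, mem_connectedComponentIn (hsub hx), hx⟩
    intro z hz
    by_contra hcon
    simp only [Set.mem_union, Set.mem_compl_iff, not_or, not_not] at hcon
    exact connectedComponentIn_subset _ _ hz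
      (c.mem_image_of_mem_closure_cell hh hj hi hcon.2 hcon.1)
  · exact ((convex_Ioo _ _).prod (convex_Ioo _ _)).isPreconnected.subset_connectedComponentIn hx
      hsub

lemma nonempty_cell (hh : 0 < h) (j i : ℕ) : (c.cell j i).Nonempty :=
  (nonempty_Ioo.mpr (by simp)).prod (nonempty_Ioo.mpr (Nat.cast_lt.mpr (by rw [mul_add]; omega)))

lemma isBoundedFace_cell (hh : 0 < h) {j i : ℕ} (hj : j + 1 < m) (hi : i < p) :
    c.embedding.IsBoundedFace (c.cell j i) := by
  obtain ⟨x, hx⟩ := c.nonempty_cell hh j i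
  exact ⟨⟨x, (c.disjoint_cell_image j i).notMem_of_mem_left hx,
    (c.connectedComponentIn_eq_cell hh hj hi hx).symm⟩,
    (Metric.isBounded_Ioo _ _).prod (Metric.isBounded_Ioo _ _)⟩

/-- A point off the drawing lies in a cell or in an unbounded convex region off the drawing. -/
lemma mem_cell_or_exists_convex (hh : 0 < h) {x : ℝ × ℝ} (hx : x ∉ c.embedding.image) :
    (∃ j i, j + 1 < m ∧ i < p ∧ x ∈ c.cell j i) ∨
      ∃ W, Convex ℝ W ∧ ¬ IsBounded W ∧ Disjoint W c.embedding.image ∧ x ∈ W := by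
  by_cases h₁ : x.1 < 0
  · refine Or.inr ⟨Iio 0 ×ˢ univ, (convex_Iio _).prod convex_univ,
      not_isBounded_prod_of_left (not_isBounded_Iio _) univ_nonempty, ?_, h₁, mem_univ _⟩
    exact Set.disjoint_left.mpr fun z hz hzi => (c.bounds_of_mem_image hzi).1.not_gt hz.1
  by_cases h₂ : x.2 < 0
  · refine Or.inr ⟨univ ×ˢ Iio 0, convex_univ.prod (convex_Iio _),
      not_isBounded_prod_of_right univ_nonempty (not_isBounded_Iio _), ?_, mem_univ _, h₂⟩
    exact Set.disjoint_left.mpr fun z hz hzi => (c.bounds_of_mem_image hzi).2.2.1.not_gt hz.2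
  by_cases h₃ : (h * p : ℕ) < x.2
  · refine Or.inr ⟨univ ×ˢ Ioi ((h * p : ℕ) : ℝ), convex_univ.prod (convex_Ioi _),
      not_isBounded_prod_of_right univ_nonempty (not_isBounded_Ioi _), ?_, mem_univ _, h₃⟩
    exact Set.disjoint_left.mpr fun z hz hzi => (c.bounds_of_mem_image hzi).2.2.2.not_gt hz.2
  by_cases h₄ : (m : ℝ) ≤ x.1
  · refine Or.inr ⟨Ici x.1 ×ˢ {x.2}, (convex_Ici _).prod (convex_singleton _),
      not_isBounded_prod_of_left (not_isBounded_Ici _) (singleton_nonempty _), ?_,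
      le_refl x.1, rfl⟩
    refine Set.disjoint_left.mpr fun z hz hzi => hx ?_
    have hz₁ : x.1 ≤ z.1 := hz.1
    have hz₂ : z.2 = x.2 := hz.2
    have hzx : z = x := by
      refine Prod.ext ?_ hz₂
      rcases (c.bounds_of_mem_image hzi).2.1 with h | h <;> linarith
    exact hzx ▸ hzi
  by_cases h₅ : (m : ℝ) < x.1 + 1
  · refine Or.inr ⟨Ioo ((m : ℝ) - 1) m ×ˢ univ, (convex_Ioo _ _).prod convex_univ,
      not_isBounded_prod_of_right ⟨x.1, by linarith, not_le.mp h₄⟩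
        (fun h => not_isBounded_Iio 0 (h.subset (subset_univ _))), ?_,
      ⟨by linarith, not_le.mp h₄⟩, mem_univ _⟩
    refine Set.disjoint_left.mpr fun z hz hzi => ?_
    have hz₁ := hz.1.1
    have hz₂ := hz.1.2
    rcases (c.bounds_of_mem_image hzi).2.1 with h | h <;> linarith
  rw [not_lt] at h₁ h₂ h₃ h₅
  have hj := Nat.floor_le h₁
  have hj' := Nat.lt_floor_add_one x.1
  have hi := Nat.floor_le h₂
  have hi' := Nat.lt_floor_add_one x.2
  have hjm : ⌊x.1⌋₊ + 1 ≤ m := by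
    have : (⌊x.1⌋₊ : ℝ) + 1 ≤ m := by linarith
    exact_mod_cast this
  have hjne : (⌊x.1⌋₊ : ℝ) ≠ x.1 := fun h =>
    hx (c.mem_image_of_column hjm h.symm h₂ h₃)
  have hjm' : ⌊x.1⌋₊ + 1 ≠ m := fun h => hjne (le_antisymm hj (by
    have : (⌊x.1⌋₊ : ℝ) + 1 = m := by exact_mod_cast h
    linarith))
  have hdiv : h * (⌊x.2⌋₊ / h) ≤ ⌊x.2⌋₊ := Nat.mul_div_le _ _
  have hdiv' : ⌊x.2⌋₊ + 1 ≤ h * (⌊x.2⌋₊ / h + 1) := Nat.lt_mul_div_succ _ hh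
  have hip : ⌊x.2⌋₊ / h ≤ p := by
    have := Nat.div_le_div_right (c := h) (Nat.floor_le_of_le h₃)
    rwa [Nat.mul_div_cancel_left _ hh] at this
  have hine : ((h * (⌊x.2⌋₊ / h) : ℕ) : ℝ) ≠ x.2 := fun h =>
    hx (c.mem_image_of_row hip h.symm h₁ h₅)
  have hdiv₁ : ((h * (⌊x.2⌋₊ / h) : ℕ) : ℝ) ≤ ⌊x.2⌋₊ := Nat.cast_le.mpr hdiv
  have hdiv₂ : (⌊x.2⌋₊ : ℝ) + 1 ≤ (h * (⌊x.2⌋₊ / h + 1) : ℕ) := by exact_mod_cast hdiv'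
  have hip' : ⌊x.2⌋₊ / h ≠ p := fun h => hine (le_antisymm (hdiv₁.trans hi) (by rwa [h]))
  exact Or.inl ⟨⌊x.1⌋₊, ⌊x.2⌋₊ / h, lt_of_le_of_ne hjm hjm', lt_of_le_of_ne hip hip',
    ⟨lt_of_le_of_ne hj hjne, hj'⟩, lt_of_le_of_ne (hdiv₁.trans hi) hine, hi'.trans_le hdiv₂⟩

lemma exists_eq_cell_of_isBoundedFace (hh : 0 < h) {f : Set (ℝ × ℝ)}
    (hf : c.embedding.IsBoundedFace f) : ∃ j i, j + 1 < m ∧ i < p ∧ f = c.cell j i := by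
  obtain ⟨⟨x, hx, rfl⟩, hb⟩ := hf
  rcases c.mem_cell_or_exists_convex hh hx with ⟨j, i, hj, hi, hxc⟩ | ⟨W, hW, hub, hd, hxW⟩
  · exact ⟨j, i, hj, hi, c.connectedComponentIn_eq_cell hh hj hi hxc⟩
  · exact absurd hb (not_isBounded_connectedComponentIn hW hub hd hxW)

lemma mem_boundaryVerts_cell (hh : 0 < h) {j i : ℕ} {u : V} :
    u ∈ c.embedding.boundaryVerts (c.cell j i) ↔
      (j ≤ c.col u ∧ c.col u ≤ j + 1) ∧ h * i ≤ c.row u ∧ c.row u ≤ h * (i + 1) := by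
  change c.point u ∈ closure (c.cell j i) ↔ _
  rw [c.closure_cell hh, Set.mem_prod, Set.mem_Icc, Set.mem_Icc]
  simp only [point]
  norm_cast

end GridCoords
namespace GridCoords

variable {V : Type} {h p m : ℕ} (c : GridCoords V h p m)

lemma ncard_boundaryVerts_le (hh : 0 < h) {f : Set (ℝ × ℝ)} (hf : c.embedding.IsBoundedFace f) :
    (c.embedding.boundaryVerts f).ncard ≤ 2 * h + 2 := by
  obtain ⟨j, i, -, -, rfl⟩ := c.exists_eq_cell_of_isBoundedFace hh hf
  have hle : (c.embedding.boundaryVerts (c.cell j i)).ncard ≤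
      (↑(Finset.Icc j (j + 1) ×ˢ Finset.Icc (h * i) (h * (i + 1))) : Set (ℕ × ℕ)).ncard := by
    refine Set.ncard_le_ncard_of_injOn (fun u => (c.col u, c.row u)) (fun u hu => ?_)
      (fun u _ v _ huv => ?_) (Finset.finite_toSet _)
    · rw [c.mem_boundaryVerts_cell hh] at hu
      simpa using and_and_and_comm.mp hu
    · exact c.ext u v (Prod.mk.inj huv).1 (Prod.mk.inj huv).2
  rw [Set.ncard_coe_finset, Finset.card_product, Nat.card_Icc, Nat.card_Icc] at hle
  have h₁ : h * (i + 1) + 1 - h * i = h + 1 := by rw [mul_add]; omega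
  have h₂ : j + 1 + 1 - j = 2 := by omega
  rw [h₁, h₂] at hle
  omega

lemma isFacial_cobag (hh : 0 < h) (hp : 1 ≤ p) (hm : 2 ≤ m) {D : Decomp V}
    (hD : IsEmDecomp c.embedding D) : c.IsFacial D.Cobag := by
  obtain ⟨⟨hcov, hedge, -⟩, hface⟩ := hD
  have hcell : ∀ j i, j + 1 < m → i < p → ∀ u v,
      (j ≤ c.col u ∧ c.col u ≤ j + 1) ∧ h * i ≤ c.row u ∧ c.row u ≤ h * (i + 1) →
      (j ≤ c.col v ∧ c.col v ≤ j + 1) ∧ h * i ≤ c.row v ∧ c.row v ≤ h * (i + 1) →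
      D.Cobag u v := fun j i hj hi u v hu hv => by
    obtain ⟨b, hb⟩ := hface _ (c.isBoundedFace_cell hh hj hi)
    exact ⟨b, hb ((c.mem_boundaryVerts_cell hh).mpr hu), hb ((c.mem_boundaryVerts_cell hh).mpr hv)⟩
  refine ⟨fun u => ?_, fun u v => ?_, fun u v hu hv hum hvm huv => ?_, fun u v hum hcol hrow => ?_,
    fun u v hvm hcol hrow => ?_⟩
  · obtain ⟨b, hb⟩ := hcov u
    exact ⟨b, hb, hb⟩
  · rintro ⟨b, hu, hv⟩
    exact ⟨b, hv, hu⟩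
  · by_cases hj : c.col u + 1 < m
    · exact hcell (c.col u) 0 hj hp u v (by omega) (by omega)
    · exact hcell (c.col u - 1) 0 (by omega) hp u v (by omega) (by omega)
  · have hstep : c.Step u v := ⟨by omega, Or.inl ⟨hcol, hrow⟩⟩
    exact hedge u v (Or.inl hstep)
  · have hi : ∃ i < p, h * i ≤ c.row u ∧ c.row u ≤ h * (i + 1) := by
      rcases (c.row_le u).lt_or_eq with hlt | heq
      · exact ⟨c.row u / h, Nat.div_lt_of_lt_mul hlt, Nat.mul_div_le _ _,
          (Nat.lt_mul_div_succ _ hh).le⟩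
      · refine ⟨p - 1, by omega, heq ▸ Nat.mul_le_mul_left h (Nat.sub_le p 1), ?_⟩
        rw [Nat.sub_add_cancel hp, heq]
    obtain ⟨i, hip, hi⟩ := hi
    exact hcell (c.col u) i (by omega) hip u v (by omega) (by omega)

lemma exists_lt_ncard_bag_of_isEmDecomp [Finite V] (hh : 0 < h) (hp : 1 ≤ p ∨ h = 1)
    (hm : 2 * (h * p + h + 1) ≤ m) {D : Decomp V} (hD : IsEmDecomp c.embedding D) :
    ∃ i, h * p + h < (D.bag i).ncard := by
  rcases Nat.eq_zero_or_pos p with rfl | hp'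
  · obtain rfl : h = 1 := hp.resolve_left (by omega)
    obtain ⟨u, hu, hu'⟩ := c.surj 0 0 (by omega) (by omega)
    obtain ⟨v, hv, hv'⟩ := c.surj 1 0 (by omega) (by omega)
    have hstep : c.Step u v := ⟨by omega, Or.inr ⟨by omega, by omega, one_dvd _⟩⟩
    obtain ⟨i, hi⟩ := hD.1.2.1 u v (Or.inl hstep)
    exact ⟨i, (Set.one_lt_ncard (Set.toFinite _)).mpr
      ⟨u, hi.1, v, hi.2, fun huv => by rw [huv] at hu; omega⟩⟩
  · exact exists_lt_ncard_bag hD.1.2.2 (c.isFacial_cobag hh hp' (by omega) hD) hp' hm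

end GridCoords

/-- An em-width bound may be checked on each em-decomposition. -/
lemma le_emwidth {V : Type} [Finite V] {G : SimpleGraph V} {P : PlaneEmbedding G} {w : ℕ}
    (hw : ∀ D : Decomp V, IsEmDecomp P D → ∃ i, w < (D.bag i).ncard) : w ≤ emwidth P := by
  refine le_csInf ⟨Nat.card V, ⟨Unit, ⊥, SimpleGraph.IsTree.of_subsingleton, fun _ => univ⟩,
    ⟨⟨fun v => ⟨(), mem_univ v⟩, fun u v _ => ⟨(), mem_univ u, mem_univ v⟩, fun v => ?_⟩,
      fun f _ => ⟨(), subset_univ _⟩⟩, fun _ => ?_⟩ ?_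
  · have : Nonempty {i : Unit | v ∈ (univ : Set V)} := ⟨⟨(), mem_univ v⟩⟩
    exact (SimpleGraph.IsTree.of_subsingleton (G := SimpleGraph.induce _ ⊥)).connected
  · rw [Set.ncard_univ]
    exact Nat.le_succ _
  · rintro k ⟨D, hD, hk⟩
    obtain ⟨i, hi⟩ := hw D hD
    exact Nat.lt_succ_iff.mp (hi.trans_le (hk i))

/-- Coordinates filling the columns of the grid one after the other. -/
def GridCoords.ofFin (n h p : ℕ) : GridCoords (Fin n) h p (n / (h * p + 1)) where
  col u := u / (h * p + 1)
  row u := u % (h * p + 1)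
  ext u v hcol hrow := Fin.ext (by
    rw [← Nat.div_add_mod u (h * p + 1), hcol, hrow, Nat.div_add_mod])
  row_le u := Nat.lt_succ_iff.mp (Nat.mod_lt _ (Nat.succ_pos _))
  col_le u := Nat.div_le_div_right u.2.le
  surj j y hj hy := by
    have hylt : y < h * p + 1 := Nat.lt_succ_of_le hy
    have hlt : y + (h * p + 1) * j < n := by
      have h₁ := Nat.mul_le_mul_left (h * p + 1) (Nat.succ_le_of_lt hj)
      have h₂ := Nat.mul_div_le n (h * p + 1)
      rw [Nat.mul_succ] at h₁
      omega
    refine ⟨⟨_, hlt⟩, ?_, ?_⟩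
    · change (y + (h * p + 1) * j) / (h * p + 1) = j
      rw [Nat.add_mul_div_left _ _ (Nat.succ_pos _), Nat.div_eq_of_lt hylt, Nat.zero_add]
    · change (y + (h * p + 1) * j) % (h * p + 1) = y
      rw [Nat.add_mul_mod_self_left, Nat.mod_eq_of_lt hylt]

/-- For every `k ≥ 1` there is `l` (namely `l = 2k + 2`) such that for
all sufficiently large `n` there is a `k`-outerplanar plane graph on `n` vertices, all
of whose bounded faces have length at most `l`, with em-width at least
`(l/2 − 1)(2k − 1)`. -/
theorem emwidth_lowerBound_outerplanar (k : ℕ) (hk : 1 ≤ k) :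
    ∃ l : ℕ, l = 2 * k + 2 ∧
      ∃ N : ℕ, ∀ n : ℕ, N ≤ n →
        ∃ (G : SimpleGraph (Fin n)) (P : PlaneEmbedding G),
          P.OuterplanarAtMost k ∧
          (∀ f, P.IsBoundedFace f → (P.boundaryVerts f).ncard ≤ l) ∧
          (l / 2 - 1) * (2 * k - 1) ≤ emwidth P := by
  obtain ⟨p, rfl⟩ : ∃ p, k = p + 1 := ⟨k - 1, (Nat.sub_add_cancel hk).symm⟩
  refine ⟨_, rfl, 2 * ((p + 1) * (2 * p) + (p + 1) + 1) * ((p + 1) * (2 * p) + 1),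
    fun n hn => ?_⟩
  let c := GridCoords.ofFin n (p + 1) (2 * p)
  refine ⟨c.graph, c.embedding, c.outerplanarAtMost p.succ_pos (by omega),
    fun f hf => c.ncard_boundaryVerts_le p.succ_pos hf, le_emwidth fun D hD => ?_⟩
  have hwidth : ((2 * (p + 1) + 2) / 2 - 1) * (2 * (p + 1) - 1) =
      (p + 1) * (2 * p) + (p + 1) := by
    rw [show (2 * (p + 1) + 2) / 2 - 1 = p + 1 by omega,
      show 2 * (p + 1) - 1 = 2 * p + 1 by omega, mul_add, mul_one]
  rw [hwidth]
  exact c.exists_lt_ncard_bag_of_isEmDecomp p.succ_pos (by omega)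
    ((Nat.le_div_iff_mul_le (Nat.succ_pos _)).mpr hn) hD
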